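/- arXiv:2202.02497 — 4 statements merged into one kernel-verified Lean document; each statement's English description precedes it below -/
import Mathlib

section
/- Let θ be an angle with 0 < θ < π and set δ := 1 − 1/(2 − cos θ). Then for every real inner product space V, every real number c > 0, and all vectors v₁, v₂ ∈ V with ‖v₁‖ ≥ c and ‖v₂ − v₁‖ ≤ δ·c, one has ⟨v₁, v₂⟩ ≥ cos(θ)·‖v₁‖·‖v₂‖. -/
open RealInnerProductSpace

/-- Let `0 < θ < π` and set `δ := 1 - 1/(2 - cos θ)`. Then for every real inner product
space `V`, every `c > 0`, and all `v₁ v₂ : V` with `‖v₁‖ ≥ c` and `‖v₂ - v₁‖ ≤ δ * c`,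
one has `⟪v₁, v₂⟫ ≥ cos θ * ‖v₁‖ * ‖v₂‖`. -/
theorem stmt_1 (θ : ℝ) (hθ0 : 0 < θ) (hθπ : θ < Real.pi)
    (V : Type*) [NormedAddCommGroup V] [InnerProductSpace ℝ V]
    (c : ℝ) (hc : 0 < c) (v₁ v₂ : V)
    (h1 : c ≤ ‖v₁‖) (h2 : ‖v₂ - v₁‖ ≤ (1 - 1 / (2 - Real.cos θ)) * c) :
    ⟪v₁, v₂⟫ ≥ Real.cos θ * ‖v₁‖ * ‖v₂‖ := by
  have hk1 : Real.cos θ < 1 := by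
    simpa using Real.cos_lt_cos_of_nonneg_of_le_pi le_rfl hθπ.le hθ0
  generalize Real.cos θ = k at *
  have hδ : 1 - 1 / (2 - k) = (1 - k) / (2 - k) := by
    have : 2 - k ≠ 0 := by linarith
    field_simp
    ring
  have hδ0 : 0 ≤ (1 - k) / (2 - k) := div_nonneg (by linarith) (by linarith)
  have hδ1 : (1 - k) / (2 - k) ≤ 1 := (div_le_one (by linarith)).2 (by linarith)
  rw [hδ] at h2
  have hd : ‖v₂ - v₁‖ ≤ (1 - k) / (2 - k) * ‖v₁‖ :=
    h2.trans (mul_le_mul_of_nonneg_left h1 hδ0)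
  have hsq : ‖v₂ - v₁‖ ^ 2 = ‖v₂‖ ^ 2 - 2 * ⟪v₁, v₂⟫ + ‖v₁‖ ^ 2 := by
    rw [norm_sub_sq_real, real_inner_comm]
  have ha := norm_nonneg v₁
  have hb := norm_nonneg v₂
  rcases le_or_gt 0 k with hk | hk
  · have hδsq : ((1 - k) / (2 - k)) ^ 2 ≤ 1 - k ^ 2 := by
      have hle : (1 - k) / (2 - k) ≤ 1 - k := div_le_self (by linarith) (by linarith)
      nlinarith
    have hdsq : ‖v₂ - v₁‖ ^ 2 ≤ (1 - k ^ 2) * ‖v₁‖ ^ 2 := by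
      calc ‖v₂ - v₁‖ ^ 2 ≤ ((1 - k) / (2 - k) * ‖v₁‖) ^ 2 := by gcongr
        _ = ((1 - k) / (2 - k)) ^ 2 * ‖v₁‖ ^ 2 := mul_pow _ _ _
        _ ≤ (1 - k ^ 2) * ‖v₁‖ ^ 2 := by gcongr
    nlinarith [sq_nonneg (‖v₂‖ - k * ‖v₁‖)]
  · have hda : ‖v₂ - v₁‖ ≤ ‖v₁‖ := hd.trans (mul_le_of_le_one_left ha hδ1)
    have hinner : 0 ≤ ⟪v₁, v₂⟫ := by
      nlinarith [pow_le_pow_left₀ (norm_nonneg (v₂ - v₁)) hda 2]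
    have hneg : k * ‖v₁‖ * ‖v₂‖ ≤ 0 :=
      mul_nonpos_of_nonpos_of_nonneg (mul_nonpos_of_nonpos_of_nonneg hk.le ha) hb
    exact hneg.trans hinner
end

section
/- Let V be a finite-dimensional real inner product space of dimension ρ ≥ 1 and let θ be an angle with 0 < θ ≤ π/2. Then the unit sphere of V can be covered by at most (1 + 2/sin θ)^ρ subsets of the sphere such that within each subset, any two unit vectors v₁, v₂ satisfy arccos(⟨v₁, v₂⟩) ≤ 2θ. -/
open RealInnerProductSpace

open MeasureTheory Metric in
/-- An `r`-separated finite set in the ball of radius `R` has at most `(1 + 2R/r) ^ dim` points. -/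
theorem card_le_of_separated_of_norm_le {E : Type*} [NormedAddCommGroup E] [NormedSpace ℝ E]
    [FiniteDimensional ℝ E] {R r : ℝ} (hR : 0 ≤ R) (hr : 0 < r) (s : Finset E)
    (hs : ∀ c ∈ s, ‖c‖ ≤ R) (h : ∀ c ∈ s, ∀ d ∈ s, c ≠ d → r ≤ ‖c - d‖) :
    (s.card : ℝ) ≤ (1 + 2 * R / r) ^ Module.finrank ℝ E := by
  borelize E
  let μ : Measure E := Measure.addHaar
  have hδ : 0 < r / 2 := half_pos hr
  have hρ : 0 < R + r / 2 := by positivity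
  have hdisj : (s : Set E).PairwiseDisjoint fun c => ball c (r / 2) := by
    intro c hc d hd hcd
    apply ball_disjoint_ball
    rw [dist_eq_norm, add_halves]
    exact h c hc d hd hcd
  have hsub : (⋃ c ∈ s, ball c (r / 2)) ⊆ ball (0 : E) (R + r / 2) := by
    refine Set.iUnion₂_subset fun x hx => ball_subset_ball' ?_
    rw [dist_zero_right]
    linarith [hs x hx]
  have hvol : (s.card : ENNReal) * ENNReal.ofReal ((r / 2) ^ Module.finrank ℝ E) * μ (ball 0 1) ≤
      ENNReal.ofReal ((R + r / 2) ^ Module.finrank ℝ E) * μ (ball 0 1) := by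
    have hle := measure_mono (μ := μ) hsub
    rw [measure_biUnion_finset hdisj fun c _ => measurableSet_ball,
      μ.addHaar_ball_of_pos _ hρ] at hle
    simpa only [μ.addHaar_ball_of_pos _ hδ, Finset.sum_const, nsmul_eq_mul, mul_assoc] using hle
  have hcard := (ENNReal.mul_le_mul_iff_left (measure_ball_pos μ _ zero_lt_one).ne'
    measure_ball_lt_top.ne).1 hvol
  have hreal := ENNReal.toReal_le_of_le_ofReal (pow_nonneg hρ.le _) hcard
  rw [ENNReal.toReal_mul, ENNReal.toReal_natCast, ENNReal.toReal_ofReal (by positivity),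
    ← le_div_iff₀ (by positivity), ← div_pow] at hreal
  have hbase : 1 + 2 * R / r = (R + r / 2) / (r / 2) := by
    field_simp
    ring
  rwa [hbase]

/-- A set contained in the ball of radius `R` has an `r`-net of at most `(1 + 2R/r) ^ dim` of its
points. -/
theorem exists_finset_net_card_le {E : Type*} [NormedAddCommGroup E] [NormedSpace ℝ E]
    [FiniteDimensional ℝ E] {R r : ℝ} (hR : 0 ≤ R) (hr : 0 < r) (A : Set E)
    (hA : ∀ v ∈ A, ‖v‖ ≤ R) :
    ∃ s : Finset E, (s : Set E) ⊆ A ∧ (s.card : ℝ) ≤ (1 + 2 * R / r) ^ Module.finrank ℝ E ∧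
      ∀ v ∈ A, ∃ c ∈ s, ‖v - c‖ < r := by
  classical
  let K : Set ℕ := {n | ∃ s : Finset E, (s : Set E) ⊆ A ∧
    (∀ c ∈ s, ∀ d ∈ s, c ≠ d → r ≤ ‖c - d‖) ∧ s.card = n}
  have hbound : ∀ s : Finset E, (s : Set E) ⊆ A → (∀ c ∈ s, ∀ d ∈ s, c ≠ d → r ≤ ‖c - d‖) →
      (s.card : ℝ) ≤ (1 + 2 * R / r) ^ Module.finrank ℝ E := fun s hsA hsep =>
    card_le_of_separated_of_norm_le hR hr s (fun c hc => hA c (hsA hc)) hsep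
  have hbdd : BddAbove K := by
    refine ⟨⌊(1 + 2 * R / r) ^ Module.finrank ℝ E⌋₊, ?_⟩
    rintro _ ⟨s, hsA, hsep, rfl⟩
    exact Nat.le_floor (hbound s hsA hsep)
  obtain ⟨s, hsA, hsep, hcard⟩ : sSup K ∈ K := Nat.sSup_mem ⟨0, ∅, by simp⟩ hbdd
  refine ⟨s, hsA, hbound s hsA hsep, fun v hv => ?_⟩
  by_contra! hfar
  have hvs : v ∉ s := fun hvs => by
    have := hfar v hvs
    rw [sub_self, norm_zero] at this
    exact hr.not_ge this
  have hmem : s.card + 1 ∈ K := by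
    refine ⟨insert v s, ?_, ?_, Finset.card_insert_of_notMem hvs⟩
    · rw [Finset.coe_insert]
      exact Set.insert_subset hv hsA
    · intro c hc d hd hcd
      rcases Finset.mem_insert.1 hc with rfl | hcs <;>
        rcases Finset.mem_insert.1 hd with rfl | hds
      · exact absurd rfl hcd
      · exact hfar d hds
      · rw [norm_sub_rev]
        exact hfar c hcs
      · exact hsep c hcs d hds hcd
  have := le_csSup hbdd hmem
  omega

/-- Unit vectors at distance at most `2 sin θ` form an angle of at most `2θ`. -/
theorem arccos_inner_le_two_mul_of_norm_sub_le {V : Type*} [NormedAddCommGroup V]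
    [InnerProductSpace ℝ V] {θ : ℝ} (hθ0 : 0 ≤ θ) (hθ : θ ≤ Real.pi / 2) {v w : V}
    (hv : ‖v‖ = 1) (hw : ‖w‖ = 1) (h : ‖v - w‖ ≤ 2 * Real.sin θ) :
    Real.arccos ⟪v, w⟫ ≤ 2 * θ := by
  have hcos : Real.cos (2 * θ) ≤ ⟪v, w⟫ := by
    have hnorm := norm_sub_sq_real v w
    have hsq := pow_le_pow_left₀ (norm_nonneg _) h 2
    rw [hv, hw] at hnorm
    rw [Real.cos_two_mul, Real.cos_sq']
    linarith
  calc Real.arccos ⟪v, w⟫ ≤ Real.arccos (Real.cos (2 * θ)) := Real.arccos_le_arccos hcos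
    _ = 2 * θ := Real.arccos_cos (by linarith) (by linarith)

/-- Let `V` be a finite-dimensional real inner product space of dimension `ρ ≥ 1` and
`0 < θ ≤ π/2`. Then the unit sphere of `V` can be covered by at most `(1 + 2/sin θ)^ρ`
subsets of the sphere such that within each subset, any two unit vectors `v₁, v₂`
satisfy `arccos ⟪v₁, v₂⟫ ≤ 2θ`. -/
theorem stmt_5 (V : Type*) [NormedAddCommGroup V] [InnerProductSpace ℝ V]
    [FiniteDimensional ℝ V] (ρ : ℕ) (hρ : 1 ≤ ρ) (hdim : Module.finrank ℝ V = ρ)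
    (θ : ℝ) (hθ0 : 0 < θ) (hθ : θ ≤ Real.pi / 2) :
    ∃ (N : ℕ) (S : Fin N → Set V), (N : ℝ) ≤ (1 + 2 / Real.sin θ) ^ ρ ∧
      (∀ i, S i ⊆ {v : V | ‖v‖ = 1}) ∧
      (∀ v : V, ‖v‖ = 1 → ∃ i, v ∈ S i) ∧
      (∀ i, ∀ v₁ ∈ S i, ∀ v₂ ∈ S i, Real.arccos ⟪v₁, v₂⟫ ≤ 2 * θ) := by
  have hsin : 0 < Real.sin θ := Real.sin_pos_of_pos_of_lt_pi hθ0 (by linarith [Real.pi_pos])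
  obtain ⟨s, -, hcard, hnet⟩ := exists_finset_net_card_le zero_le_one hsin {v : V | ‖v‖ = 1}
    fun v hv => le_of_eq hv
  rw [mul_one, hdim] at hcard
  refine ⟨s.card, fun i => {v | ‖v‖ = 1 ∧ ‖v - s.equivFin.symm i‖ < Real.sin θ}, hcard,
    fun i v hv => hv.1, fun v hv => ?_, fun i v hv w hw => ?_⟩
  · obtain ⟨c, hc, hvc⟩ := hnet v hv
    exact ⟨s.equivFin ⟨c, hc⟩, hv, by simpa using hvc⟩
  · refine arccos_inner_le_two_mul_of_norm_sub_le hθ0.le hθ hv.1 hw.1 ?_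
    have htri := norm_sub_le_norm_sub_add_norm_sub v (s.equivFin.symm i : V) w
    rw [norm_sub_rev (s.equivFin.symm i : V) w] at htri
    linarith [hv.2, hw.2]
end

section
/- Let V be a finite-dimensional real inner product space of dimension ρ ≥ 1 and let c > 1 be a real number. Then there exist a natural number N with N ≤ (1 + √(8c))^ρ and subsets S₁, …, S_N of V whose union is all of V, such that for each i and any two vectors v₁, v₂ ∈ S_i one has ⟨v₁, v₂⟩ ≥ (1 − 1/c)·‖v₁‖·‖v₂‖. -/
open RealInnerProductSpace

section Packing

open MeasureTheory Metric Module Function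
open scoped ENNReal

/-- Volume bound on the size of an `r`-separated finite subset of the closed unit ball. -/
theorem Finset.card_le_of_separated_of_norm_le_one {E : Type*} [NormedAddCommGroup E]
    [NormedSpace ℝ E] [FiniteDimensional ℝ E] {r : ℝ} (hr : 0 < r) (s : Finset E)
    (hs : ∀ x ∈ s, ‖x‖ ≤ 1) (h : (s : Set E).Pairwise fun x y => r ≤ dist x y) :
    (s.card : ℝ) ≤ (1 + 2 / r) ^ finrank ℝ E := by
  borelize E
  let μ : Measure E := Measure.addHaar
  have hδ : 0 < r / 2 := by positivity
  have hR : 0 < 1 + r / 2 := by positivity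
  have disj : (s : Set E).Pairwise (Disjoint on fun x => ball x (r / 2)) := by
    intro x hx y hy hxy
    apply ball_disjoint_ball
    linarith [h hx hy hxy]
  have sub : (⋃ x ∈ s, ball x (r / 2)) ⊆ ball (0 : E) (1 + r / 2) := by
    refine Set.iUnion₂_subset fun x hx => ball_subset_ball' ?_
    rw [dist_zero_right]
    linarith [hs x hx]
  have vol : (s.card : ℝ≥0∞) * ENNReal.ofReal ((r / 2) ^ finrank ℝ E) * μ (ball 0 1) ≤
      ENNReal.ofReal ((1 + r / 2) ^ finrank ℝ E) * μ (ball 0 1) :=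
    calc
      _ = μ (⋃ x ∈ s, ball x (r / 2)) := by
        rw [measure_biUnion_finset disj fun _ _ => measurableSet_ball]
        simp only [μ.addHaar_ball_of_pos _ hδ, Finset.sum_const, nsmul_eq_mul, mul_assoc]
      _ ≤ μ (ball (0 : E) (1 + r / 2)) := measure_mono sub
      _ = _ := μ.addHaar_ball_of_pos _ hR
  have key := ENNReal.toReal_le_of_le_ofReal (by positivity) <|
    (ENNReal.mul_le_mul_iff_left (measure_ball_pos _ _ zero_lt_one).ne'
      measure_ball_lt_top.ne).1 vol
  rw [ENNReal.toReal_mul, ENNReal.toReal_natCast, ENNReal.toReal_ofReal (by positivity)] at key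
  rw [show 1 + 2 / r = (1 + r / 2) / (r / 2) by field_simp; ring, div_pow]
  exact (le_div_iff₀ (by positivity)).2 key

/-- The closed unit ball of a finite-dimensional space is covered by at most
`(1 + 2 / r) ^ finrank ℝ E` balls of radius `r`. -/
theorem exists_finset_cover_closedBall_zero_one (E : Type*) [NormedAddCommGroup E]
    [NormedSpace ℝ E] [FiniteDimensional ℝ E] {r : ℝ} (hr : 0 < r) :
    ∃ s : Finset E, (s.card : ℝ) ≤ (1 + 2 / r) ^ finrank ℝ E ∧
      ∀ x : E, ‖x‖ ≤ 1 → ∃ p ∈ s, dist x p ≤ r := by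
  classical
  let P : Finset E → Prop := fun s =>
    (∀ x ∈ s, ‖x‖ ≤ 1) ∧ (s : Set E).Pairwise fun x y => r ≤ dist x y
  have bound (s : Finset E) (hs : P s) : (s.card : ℝ) ≤ (1 + 2 / r) ^ finrank ℝ E :=
    s.card_le_of_separated_of_norm_le_one hr hs.1 hs.2
  have bdd : BddAbove (Finset.card '' {s : Finset E | P s}) := by
    refine ⟨⌊(1 + 2 / r) ^ finrank ℝ E⌋₊, ?_⟩
    rintro _ ⟨s, hs, rfl⟩
    exact Nat.le_floor (bound s hs)
  obtain ⟨s, hs, hmax⟩ := Nat.sSup_mem (s := Finset.card '' {s : Finset E | P s})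
    ⟨0, ∅, by simp [P], rfl⟩ bdd
  refine ⟨s, bound s hs, fun x hx => ?_⟩
  by_contra! hfar
  have hxs : x ∉ s := fun hmem => by
    have := hfar x hmem
    rw [dist_self] at this
    exact this.not_gt hr
  have hP : P (insert x s) := by
    refine ⟨by simpa [hx] using hs.1, ?_⟩
    rw [Finset.coe_insert]
    refine hs.2.insert fun y hy _ => ⟨(hfar y hy).le, ?_⟩
    rw [dist_comm]
    exact (hfar y hy).le
  have := le_csSup bdd ⟨_, hP, rfl⟩
  rw [← hmax, Finset.card_insert_of_notMem hxs] at this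
  omega

end Packing

/-- Vectors whose normalizations are close make a small angle. -/
theorem one_sub_mul_norm_mul_norm_le_inner {V : Type*} [NormedAddCommGroup V]
    [InnerProductSpace ℝ V] {d : ℝ} (v w : V)
    (h : dist (‖v‖⁻¹ • v) (‖w‖⁻¹ • w) ≤ d) :
    (1 - d ^ 2 / 2) * ‖v‖ * ‖w‖ ≤ ⟪v, w⟫ := by
  rcases eq_or_ne v 0 with rfl | hv
  · simp
  rcases eq_or_ne w 0 with rfl | hw
  · simp
  have hv' : 0 < ‖v‖ := norm_pos_iff.2 hv
  have hw' : 0 < ‖w‖ := norm_pos_iff.2 hw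
  have hsq : ‖‖v‖⁻¹ • v - ‖w‖⁻¹ • w‖ ^ 2 ≤ d ^ 2 := by
    rw [← dist_eq_norm]
    gcongr
  have hinner : ⟪v, w⟫ = ⟪‖v‖⁻¹ • v, ‖w‖⁻¹ • w⟫ * (‖v‖ * ‖w‖) := by
    rw [real_inner_smul_left, real_inner_smul_right]
    field_simp
  have hunit (u : V) (hu : 0 < ‖u‖) : ‖‖u‖⁻¹ • u‖ = 1 := by
    rw [norm_smul, norm_inv, norm_norm, inv_mul_cancel₀ hu.ne']
  rw [norm_sub_sq_real, hunit v hv', hunit w hw'] at hsq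
  rw [hinner, mul_assoc]
  gcongr
  linarith

/-- Let `V` be a finite-dimensional real inner product space of dimension `ρ ≥ 1` and
`c > 1`. Then there exist `N ≤ (1 + √(8c))^ρ` and subsets `S₁, …, S_N` of `V` covering
`V` such that for each `i` and all `v₁, v₂ ∈ Sᵢ` one has
`⟪v₁, v₂⟫ ≥ (1 - 1/c) * ‖v₁‖ * ‖v₂‖`. -/
theorem stmt_6 (V : Type*) [NormedAddCommGroup V] [InnerProductSpace ℝ V]
    [FiniteDimensional ℝ V] (ρ : ℕ) (hρ : 1 ≤ ρ) (hdim : Module.finrank ℝ V = ρ)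
    (c : ℝ) (hc : 1 < c) :
    ∃ (N : ℕ) (S : Fin N → Set V), (N : ℝ) ≤ (1 + Real.sqrt (8 * c)) ^ ρ ∧
      (⋃ i, S i) = Set.univ ∧
      (∀ i, ∀ v₁ ∈ S i, ∀ v₂ ∈ S i, ⟪v₁, v₂⟫ ≥ (1 - 1 / c) * ‖v₁‖ * ‖v₂‖) := by
  have hc0 : 0 < c := by linarith
  have hsqrt : 0 < Real.sqrt (8 * c) := Real.sqrt_pos.2 (by positivity)
  have hsq : Real.sqrt (8 * c) ^ 2 = 8 * c := Real.sq_sqrt (by positivity)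
  obtain ⟨s, hcard, hcover⟩ := exists_finset_cover_closedBall_zero_one V
    (show 0 < 2 / Real.sqrt (8 * c) by positivity)
  rw [hdim, div_div_cancel₀ two_ne_zero] at hcard
  refine ⟨s.card, fun i => {v | dist (‖v‖⁻¹ • v) (s.equivFin.symm i : V) ≤
    2 / Real.sqrt (8 * c)}, hcard, ?_, ?_⟩
  · refine Set.eq_univ_of_forall fun v => ?_
    have hnorm : ‖‖v‖⁻¹ • v‖ ≤ 1 := by
      rw [norm_smul, norm_inv, norm_norm]
      exact inv_mul_le_one
    obtain ⟨p, hp, hvp⟩ := hcover _ hnorm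
    exact Set.mem_iUnion.2 ⟨s.equivFin ⟨p, hp⟩, by simpa using hvp⟩
  · intro i v hv w hw
    have h := one_sub_mul_norm_mul_norm_le_inner v w
      ((dist_triangle_right _ _ _).trans (add_le_add hv hw))
    have hd : (2 / Real.sqrt (8 * c) + 2 / Real.sqrt (8 * c)) ^ 2 / 2 = 1 / c := by
      rw [← two_mul, mul_pow, div_pow, hsq]
      field_simp
      norm_num
    rwa [hd] at h
end

section
/- Let V be a real inner product space, let c₁ > 1 and c₂ > 0 be real numbers, and set θ₁ := (1/2)·(arccos(1 − 1/c₁) − arccos(1 − 1/(2c₁))). Then there exists a real number ε₁ with 0 < ε₁ ≤ c₂ such that the following holds: for every subset D ⊆ V satisfying ⟨w₁, w₂⟩ ≥ (1 − 1/(2c₁))·‖w₁‖·‖w₂‖ for all w₁, w₂ ∈ D, and for all vectors v₁, v₂ ∈ V such that ‖v_i‖ > 2·√(c₂) and there exists w_i ∈ D with ‖v_i − w_i‖ < √(ε₁) (for i = 1, 2), one has ⟨v₁, v₂⟩ ≥ (1 − 1/c₁)·‖v₁‖·‖v₂‖. -/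
open RealInnerProductSpace

theorem le_inner_of_norm_sub_le {V : Type*} [NormedAddCommGroup V] [InnerProductSpace ℝ V]
    {a δ : ℝ} (ha₀ : 0 ≤ a) (ha₁ : a ≤ 1) (hδ₀ : 0 ≤ δ) (hδ₁ : δ ≤ 1) {v₁ v₂ w₁ w₂ : V}
    (hw : a * ‖w₁‖ * ‖w₂‖ ≤ ⟪w₁, w₂⟫)
    (h₁ : ‖v₁ - w₁‖ ≤ δ * ‖v₁‖) (h₂ : ‖v₂ - w₂‖ ≤ δ * ‖v₂‖) :
    (a - 5 * δ) * ‖v₁‖ * ‖v₂‖ ≤ ⟪v₁, v₂⟫ := by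
  have hn₁ := norm_nonneg v₁
  have hn₂ := norm_nonneg v₂
  have hl₁ : (1 - δ) * ‖v₁‖ ≤ ‖w₁‖ := by linarith [norm_sub_norm_le v₁ w₁]
  have hl₂ : (1 - δ) * ‖v₂‖ ≤ ‖w₂‖ := by linarith [norm_sub_norm_le v₂ w₂]
  have hu₂ : ‖w₂‖ ≤ (1 + δ) * ‖v₂‖ := by
    linarith [norm_sub_norm_le w₂ v₂, norm_sub_rev v₂ w₂]
  have hsplit : ⟪v₁, v₂⟫ = ⟪w₁, w₂⟫ + ⟪v₁ - w₁, w₂⟫ + ⟪v₁, v₂ - w₂⟫ := by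
    rw [inner_sub_left, inner_sub_right]
    ring
  have hi₁ : -((δ * ‖v₁‖) * ((1 + δ) * ‖v₂‖)) ≤ ⟪v₁ - w₁, w₂⟫ := by
    have := neg_le_of_abs_le (abs_real_inner_le_norm (v₁ - w₁) w₂)
    have : ‖v₁ - w₁‖ * ‖w₂‖ ≤ (δ * ‖v₁‖) * ((1 + δ) * ‖v₂‖) := by gcongr
    linarith
  have hi₂ : -(‖v₁‖ * (δ * ‖v₂‖)) ≤ ⟪v₁, v₂ - w₂⟫ := by
    have := neg_le_of_abs_le (abs_real_inner_le_norm v₁ (v₂ - w₂))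
    have : ‖v₁‖ * ‖v₂ - w₂‖ ≤ ‖v₁‖ * (δ * ‖v₂‖) := by gcongr
    linarith
  have hprod : a * (((1 - δ) * ‖v₁‖) * ((1 - δ) * ‖v₂‖)) ≤ a * (‖w₁‖ * ‖w₂‖) := by
    have : 0 ≤ 1 - δ := by linarith
    gcongr
  have hcoeff : 0 ≤ a * (1 - δ) ^ 2 - δ * (1 + δ) - δ - (a - 5 * δ) := by
    nlinarith [mul_nonneg hδ₀ (sub_nonneg.2 ha₁), mul_nonneg hδ₀ (sub_nonneg.2 hδ₁),
      mul_nonneg ha₀ (sq_nonneg δ)]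
  have := mul_nonneg hcoeff (mul_nonneg hn₁ hn₂)
  linarith

/-- Let `V` be a real inner product space, `c₁ > 1`, `c₂ > 0`, and set
`θ₁ := (1/2) * (arccos (1 - 1/c₁) - arccos (1 - 1/(2c₁)))`. Then there exists
`0 < ε₁ ≤ c₂` such that: for every `D ⊆ V` with `⟪w₁, w₂⟫ ≥ (1 - 1/(2c₁)) * ‖w₁‖ * ‖w₂‖`
for all `w₁, w₂ ∈ D`, and all `v₁, v₂ : V` with `‖vᵢ‖ > 2√c₂` lying within distance
`√ε₁` of some point of `D`, one has `⟪v₁, v₂⟫ ≥ (1 - 1/c₁) * ‖v₁‖ * ‖v₂‖`. -/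
theorem stmt_9 (V : Type*) [NormedAddCommGroup V] [InnerProductSpace ℝ V]
    (c₁ c₂ : ℝ) (hc₁ : 1 < c₁) (hc₂ : 0 < c₂)
    (θ₁ : ℝ)
    (hθ₁ : θ₁ = (1 / 2) * (Real.arccos (1 - 1 / c₁) - Real.arccos (1 - 1 / (2 * c₁)))) :
    ∃ ε₁ : ℝ, 0 < ε₁ ∧ ε₁ ≤ c₂ ∧
      ∀ D : Set V,
        (∀ w₁ ∈ D, ∀ w₂ ∈ D, ⟪w₁, w₂⟫ ≥ (1 - 1 / (2 * c₁)) * ‖w₁‖ * ‖w₂‖) →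
        ∀ v₁ v₂ : V,
          ‖v₁‖ > 2 * Real.sqrt c₂ → ‖v₂‖ > 2 * Real.sqrt c₂ →
          (∃ w₁ ∈ D, ‖v₁ - w₁‖ < Real.sqrt ε₁) →
          (∃ w₂ ∈ D, ‖v₂ - w₂‖ < Real.sqrt ε₁) →
          ⟪v₁, v₂⟫ ≥ (1 - 1 / c₁) * ‖v₁‖ * ‖v₂‖ := by
  have hc₁_pos : 0 < c₁ := by linarith
  have hsqrt : √(c₂ / (5 * c₁) ^ 2) = 1 / (10 * c₁) * (2 * √c₂) := by
    rw [Real.sqrt_div hc₂.le, Real.sqrt_sq (by positivity)]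
    field_simp
    norm_num
  have hinv : 1 / c₁ ≤ 1 := (div_le_one hc₁_pos).2 hc₁.le
  have hinv_pos : 0 < 1 / c₁ := by positivity
  have hhalf : 1 / (2 * c₁) = 1 / c₁ / 2 := by field_simp
  have htenth : 1 / (10 * c₁) = 1 / c₁ / 10 := by field_simp
  refine ⟨c₂ / (5 * c₁) ^ 2, by positivity, div_le_self hc₂.le (by nlinarith), ?_⟩
  rintro D hD v₁ v₂ hv₁ hv₂ ⟨w₁, hw₁, h₁⟩ ⟨w₂, hw₂, h₂⟩
  rw [hsqrt] at h₁ h₂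
  have hclose {v w : V} (hv : ‖v‖ > 2 * √c₂) (h : ‖v - w‖ < 1 / (10 * c₁) * (2 * √c₂)) :
      ‖v - w‖ ≤ 1 / (10 * c₁) * ‖v‖ := h.le.trans (by gcongr)
  have := le_inner_of_norm_sub_le (by linarith) (by linarith) (by positivity) (by linarith)
    (hD w₁ hw₁ w₂ hw₂) (hclose hv₁ h₁) (hclose hv₂ h₂)
  rwa [show 1 - 1 / (2 * c₁) - 5 * (1 / (10 * c₁)) = 1 - 1 / c₁ by
    rw [hhalf, htenth]; ring] at this
end
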